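/- For a convex quadrilateral ABCD, the diagonal AC satisfies the Delaunay (empty circumcircle) condition if and only if the sum of the angles at B (in triangle ABC) and at D (in triangle ACD) is at most π. -/

import Mathlib

noncomputable section

/-- The plane. -/
abbrev Plane := EuclideanSpace ℝ (Fin 2)

/-- The circumcenter of the nondegenerate triangle `A B C`. -/
def circumcenter3 (A B C : Plane) (h : AffineIndependent ℝ ![A, B, C]) : Plane :=
  (⟨![A, B, C], h⟩ : Affine.Simplex ℝ Plane 2).circumcenter

/-- The circumradius of the nondegenerate triangle `A B C`. -/
def circumradius3 (A B C : Plane) (h : AffineIndependent ℝ ![A, B, C]) : ℝ :=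
  (⟨![A, B, C], h⟩ : Affine.Simplex ℝ Plane 2).circumradius

/-- `D` lies strictly inside the circumcircle of the triangle `A B C`. -/
def StrictlyInsideCircumcircle (D A B C : Plane)
    (h : AffineIndependent ℝ ![A, B, C]) : Prop :=
  dist D (circumcenter3 A B C h) < circumradius3 A B C h

/-- In coordinates, the sine of the angle is the absolute cross product over the norms. -/
theorem sin_mul_eq_cross (x y : Plane) :
    Real.sin (InnerProductGeometry.angle x y) * (‖x‖ * ‖y‖) = |x 0 * y 1 - x 1 * y 0| := by
  rw [InnerProductGeometry.sin_angle_mul_norm_mul_norm, ← Real.sqrt_sq_eq_abs]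
  congr 1
  simp only [PiLp.inner_apply, Fin.sum_univ_two, RCLike.inner_apply, conj_trivial]
  ring

open EuclideanGeometry in
/-- Angle form of the Delaunay criterion: for a convex quadrilateral `ABCD`
(diagonals cross, no three points collinear), the diagonal `AC` satisfies the
empty-circumcircle condition — `D` is not strictly inside the circumcircle of
`ABC` — iff the opposite angles satisfy `∠ABC + ∠CDA ≤ π`. -/
theorem delaunay_iff_angle_sum_le_pi (A B C D : Plane)
    (hABC : AffineIndependent ℝ ![A, B, C])
    (hACD : AffineIndependent ℝ ![A, C, D])
    (hABD : AffineIndependent ℝ ![A, B, D])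
    (hBCD : AffineIndependent ℝ ![B, C, D])
    (hconv : (openSegment ℝ A C ∩ openSegment ℝ B D).Nonempty) :
    ¬ StrictlyInsideCircumcircle D A B C hABC ↔
      ∠ A B C + ∠ C D A ≤ Real.pi := by
  obtain ⟨P, ⟨s', s, hs', hs, hss, hP1⟩, ⟨t', t, ht', ht, htt, hP2⟩⟩ := hconv
  have nc1 : ¬ Collinear ℝ {A, B, C} := affineIndependent_iff_not_collinear_set.1 hABC
  have nc2 : ¬ Collinear ℝ {C, D, A} := by
    have := affineIndependent_iff_not_collinear_set.1 hACD
    rwa [show ({C, D, A} : Set Plane) = {A, C, D} by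
      ext x; simp only [Set.mem_insert_iff, Set.mem_singleton_iff]; tauto]
  have sa := EuclideanGeometry.sin_pos_of_not_collinear nc1
  have hb0 : 0 ≤ ∠ C D A := EuclideanGeometry.angle_nonneg _ _ _
  have ha0 : 0 ≤ ∠ A B C := EuclideanGeometry.angle_nonneg _ _ _
  have hapi := EuclideanGeometry.angle_lt_pi_of_not_collinear nc1
  have hbpi := EuclideanGeometry.angle_lt_pi_of_not_collinear nc2
  have hapos := EuclideanGeometry.angle_pos_of_not_collinear nc1
  have hbpos := EuclideanGeometry.angle_pos_of_not_collinear nc2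
  have hAB : A ≠ B := by rintro rfl; exact nc1 (by simpa using collinear_pair ℝ A C)
  have hCB : C ≠ B := by rintro rfl; exact nc1 (by simpa using collinear_pair ℝ A C)
  have hCD : C ≠ D := by rintro rfl; exact nc2 (by simpa using collinear_pair ℝ C A)
  have hAD : A ≠ D := by rintro rfl; exact nc2 (by simpa using collinear_pair ℝ C A)
  have n1 : 0 < ‖A - B‖ * ‖C - B‖ :=
    mul_pos (norm_pos_iff.2 (sub_ne_zero.2 hAB)) (norm_pos_iff.2 (sub_ne_zero.2 hCB))
  have n2 : 0 < ‖C - D‖ * ‖A - D‖ :=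
    mul_pos (norm_pos_iff.2 (sub_ne_zero.2 hCD)) (norm_pos_iff.2 (sub_ne_zero.2 hAD))
  have sin1 := sin_mul_eq_cross (A - B) (C - B)
  have sin2 := sin_mul_eq_cross (C - D) (A - D)
  have cos1 := InnerProductGeometry.cos_angle_mul_norm_mul_norm (A - B) (C - B)
  have cos2 := InnerProductGeometry.cos_angle_mul_norm_mul_norm (C - D) (A - D)
  change Real.sin (∠ A B C) * _ = _ at sin1
  change Real.sin (∠ C D A) * _ = _ at sin2
  change Real.cos (∠ A B C) * _ = _ at cos1
  change Real.cos (∠ C D A) * _ = _ at cos2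
  have hc : 0 < |(A - B) 0 * (C - B) 1 - (A - B) 1 * (C - B) 0| := by
    rw [← sin1]; exact mul_pos sa n1
  have hsum : ∠ A B C + ∠ C D A ≤ Real.pi ↔ 0 ≤ Real.sin (∠ A B C + ∠ C D A) := by
    constructor
    · intro h; exact Real.sin_nonneg_of_nonneg_of_le_pi (by linarith) h
    · intro h
      by_contra! h'
      have := Real.sin_pos_of_pos_of_lt_pi (x := ∠ A B C + ∠ C D A - Real.pi)
        (by linarith) (by linarith)
      rw [Real.sin_sub_pi] at this
      linarith
  set O := circumcenter3 A B C hABC with hO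
  set R := circumradius3 A B C hABC with hR
  have hRA : dist A O = R :=
    (⟨![A, B, C], hABC⟩ : Affine.Simplex ℝ Plane 2).dist_circumcenter_eq_circumradius 0
  have hRB : dist B O = R :=
    (⟨![A, B, C], hABC⟩ : Affine.Simplex ℝ Plane 2).dist_circumcenter_eq_circumradius 1
  have hRC : dist C O = R :=
    (⟨![A, B, C], hABC⟩ : Affine.Simplex ℝ Plane 2).dist_circumcenter_eq_circumradius 2
  have hR0 : 0 ≤ R := hRA ▸ dist_nonneg
  have key : StrictlyInsideCircumcircle D A B C hABC ↔ dist D O ^ 2 - R ^ 2 < 0 := by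
    unfold StrictlyInsideCircumcircle
    rw [← hO, ← hR, sub_neg, sq_lt_sq₀ dist_nonneg hR0]
  have dsq : ∀ X : Plane, dist X O ^ 2 = (X 0 - O 0) ^ 2 + (X 1 - O 1) ^ 2 := by
    intro X
    rw [EuclideanSpace.dist_eq, Real.sq_sqrt (by positivity)]
    simp [Fin.sum_univ_two, Real.dist_eq, sq_abs]
  have eA := dsq A
  have eB := dsq B
  have eC := dsq C
  have eD := dsq D
  rw [hRA] at eA
  rw [hRB] at eB
  rw [hRC] at eC
  have q0 : s' * A 0 + s * C 0 = t' * B 0 + t * D 0 := by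
    have := congrArg (fun X : Plane => X 0) (hP1.trans hP2.symm)
    simpa using this
  have q1 : s' * A 1 + s * C 1 = t' * B 1 + t * D 1 := by
    have := congrArg (fun X : Plane => X 1) (hP1.trans hP2.symm)
    simpa using this
  obtain rfl : s' = 1 - s := by linarith
  obtain rfl : t' = 1 - t := by linarith
  simp only [PiLp.inner_apply, Fin.sum_univ_two, RCLike.inner_apply, conj_trivial,
    PiLp.sub_apply] at sin1 sin2 cos1 cos2 hc
  set c := (A 0 - B 0) * (C 1 - B 1) - (A 1 - B 1) * (C 0 - B 0) with hcdef
  set c2 := (C 0 - D 0) * (A 1 - D 1) - (C 1 - D 1) * (A 0 - D 0) with hc2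
  have hcc : t * c2 = (1 - t) * c := by
    rw [hcdef, hc2]
    linear_combination (C 0 - A 0) * q1 - (C 1 - A 1) * q0
  have hcc' : t * |c2| = (1 - t) * |c| := by
    rw [← abs_of_pos ht, ← abs_mul, hcc, abs_mul, abs_of_pos ht, abs_of_pos ht']
  have hpow : (dist D O ^ 2 - R ^ 2) * c =
      c * ((A 0 - D 0) * (C 0 - D 0) + (A 1 - D 1) * (C 1 - D 1)) +
      c2 * ((C 0 - B 0) * (A 0 - B 0) + (C 1 - B 1) * (A 1 - B 1)) := by
    rw [eD, hcdef, hc2]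
    linear_combination
      (-((D 0 - B 0) * (C 1 - B 1) - (D 1 - B 1) * (C 0 - B 0))) * eA
      - ((A 0 - B 0) * (D 1 - B 1) - (A 1 - B 1) * (D 0 - B 0)) * eC
      - (((A 0 - B 0) * (C 1 - B 1) - (A 1 - B 1) * (C 0 - B 0))
        - ((D 0 - B 0) * (C 1 - B 1) - (D 1 - B 1) * (C 0 - B 0))
        - ((A 0 - B 0) * (D 1 - B 1) - (A 1 - B 1) * (D 0 - B 0))) * eB
  have hc0 : c ≠ 0 := abs_pos.1 hc
  have hpow2 : t * (dist D O ^ 2 - R ^ 2) =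
      t * ((A 0 - D 0) * (C 0 - D 0) + (A 1 - D 1) * (C 1 - D 1)) +
      (1 - t) * ((C 0 - B 0) * (A 0 - B 0) + (C 1 - B 1) * (A 1 - B 1)) := by
    apply mul_right_cancel₀ hc0
    linear_combination t * hpow +
      ((C 0 - B 0) * (A 0 - B 0) + (C 1 - B 1) * (A 1 - B 1)) * hcc
  have hfin : Real.sin (∠ A B C + ∠ C D A) *
      ((‖A - B‖ * ‖C - B‖) * (‖C - D‖ * ‖A - D‖)) = |c| * (dist D O ^ 2 - R ^ 2) := by
    apply mul_left_cancel₀ ht.ne'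
    rw [Real.sin_add]
    generalize ‖A - B‖ * ‖C - B‖ = N1 at *
    generalize ‖C - D‖ * ‖A - D‖ = N2 at *
    generalize (A 0 - D 0) * (C 0 - D 0) + (A 1 - D 1) * (C 1 - D 1) = I2 at *
    generalize (C 0 - B 0) * (A 0 - B 0) + (C 1 - B 1) * (A 1 - B 1) = I1 at *
    calc t * ((Real.sin (∠ A B C) * Real.cos (∠ C D A)
          + Real.cos (∠ A B C) * Real.sin (∠ C D A)) * (N1 * N2))
        = t * ((Real.sin (∠ A B C) * N1) * (Real.cos (∠ C D A) * N2)
          + (Real.cos (∠ A B C) * N1) * (Real.sin (∠ C D A) * N2)) := by ring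
      _ = t * (|c| * I2 + I1 * |c2|) := by rw [sin1, sin2, cos1, cos2]
      _ = t * (|c| * (dist D O ^ 2 - R ^ 2)) := by
        linear_combination I1 * hcc' - |c| * hpow2
  rw [key, hsum, not_lt,
    ← mul_nonneg_iff_of_pos_right (b := Real.sin (∠ A B C + ∠ C D A)) (mul_pos n1 n2), hfin,
    mul_nonneg_iff_of_pos_left hc]

end
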